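/- Let n ≥ 1, 1 ≤ p < ∞, α ∈ ℝ, and let (φ,ψ) be a parabolic Littlewood–Paley family on ℝ^{n+1}. There exist constants c, C > 0 (depending only on n, p, α, φ, ψ) such that for every Schwartz function f on ℝ^{n+1}: c·N_{α,p}(f) ≤ N_{α−1,p}(f) + Σ_{k=1}^{n} N_{α−1,p}(∂_{X_k}f) + N_{α−1,p}(D_t^{1/2}f) ≤ C·N_{α,p}(f). -/

import Mathlib

noncomputable section

open MeasureTheory Real Complex
open scoped ENNReal NNReal Real BigOperators

/-- Euclidean space `ℝⁿ`. -/
abbrev Rn (n : ℕ) : Type := EuclideanSpace ℝ (Fin n)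

/-- The space `ℝ^{n+1} = ℝⁿ × ℝ`, points written `(X, t)`. -/
abbrev Rn1 (n : ℕ) : Type := EuclideanSpace ℝ (Fin n) × ℝ

/-- Fourier transform on `ℝ^{n+1}`:
`𝓕f(ξ,τ) = ∫ e^{−2πi(X·ξ + tτ)} f(X,t) dX dt`. -/
def FT1 {n : ℕ} (f : Rn1 n → ℂ) (q : Rn1 n) : ℂ :=
  ∫ p : Rn1 n,
    Complex.exp (-(2 * (π : ℂ) * Complex.I) *
      (((∑ k, p.1 k * q.1 k) + p.2 * q.2 : ℝ) : ℂ)) * f p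

/-- Inverse Fourier transform on `ℝ^{n+1}`. -/
def IFT1 {n : ℕ} (f : Rn1 n → ℂ) (x : Rn1 n) : ℂ :=
  ∫ q : Rn1 n,
    Complex.exp ((2 * (π : ℂ) * Complex.I) *
      (((∑ k, q.1 k * x.1 k) + q.2 * x.2 : ℝ) : ℂ)) * f q

/-- The Fourier multiplier operator `f ↦ 𝓕⁻¹(m · 𝓕 f)` on `ℝ^{n+1}`. -/
def MOp {n : ℕ} (m : Rn1 n → ℂ) (f : Rn1 n → ℂ) : Rn1 n → ℂ :=
  IFT1 (fun q => m q * FT1 f q)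

/-- The symbol `m_α(ξ,τ) = (1 + 4π²|ξ|² + iτ)^{α/2}` (principal branch). -/
def mSym {n : ℕ} (α : ℝ) (q : Rn1 n) : ℂ :=
  (1 + 4 * (π : ℂ) ^ 2 * (‖q.1‖ : ℂ) ^ 2 + Complex.I * (q.2 : ℂ)) ^ ((α : ℂ) / 2)

/-- Partial derivative `∂_{X_k}`. -/
def dX {n : ℕ} (k : Fin n) (f : Rn1 n → ℂ) : Rn1 n → ℂ :=
  fun x => fderiv ℝ f x (EuclideanSpace.single k 1, 0)

/-- Partial derivative `∂_t`. -/
def dT {n : ℕ} (f : Rn1 n → ℂ) : Rn1 n → ℂ :=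
  fun x => fderiv ℝ f x (0, 1)

/-- Iterated spatial derivative `D_X^β` for a multi-index `β`. -/
def dXmulti {n : ℕ} (β : Fin n → ℕ) (f : Rn1 n → ℂ) : Rn1 n → ℂ :=
  (List.finRange n).foldr (fun k g => (dX k)^[β k] g) f

/-- The half time-derivative `D_t^{1/2} f = 𝓕⁻¹(|τ|^{1/2}·𝓕f)`. -/
def halfDt {n : ℕ} (f : Rn1 n → ℂ) : Rn1 n → ℂ :=
  MOp (fun q => ((|q.2| ^ ((1 : ℝ) / 2) : ℝ) : ℂ)) f

/-- The `Lᵖ(ℝ^{n+1})` norm (as a value in `ℝ≥0∞`), `p` a real exponent. -/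
def pNorm {n : ℕ} (p : ℝ) (f : Rn1 n → ℂ) : ℝ≥0∞ :=
  eLpNorm f (ENNReal.ofReal p) volume

/-- Multi-indices `β ∈ ℕⁿ` with `|β| = N`. -/
def multiIdx (n N : ℕ) : Finset (Fin n → ℕ) :=
  (Fintype.piFinset fun _ : Fin n => Finset.range (N + 1)).filter fun β => (∑ k, β k) = N

/-- Convolution on `ℝ^{n+1}`. -/
def conv1 {n : ℕ} (g f : Rn1 n → ℂ) : Rn1 n → ℂ :=
  fun x => ∫ y : Rn1 n, g (x - y) * f y

/-- A parabolic Littlewood–Paley family on `ℝ^{n+1}`. -/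
structure ParabolicLP (n : ℕ) where
  φ : SchwartzMap (Rn1 n) ℂ
  ψ : SchwartzMap (Rn1 n) ℂ
  ft_pos : ∀ q : Rn1 n,
    1 / 2 < ‖q.1‖ + |q.2| ^ ((1 : ℝ) / 2) → ‖q.1‖ + |q.2| ^ ((1 : ℝ) / 2) < 2 →
      0 < (FT1 (⇑φ) q).re ∧ (FT1 (⇑φ) q).im = 0
  ft_supp : ∀ q : Rn1 n,
    ¬(1 / 2 < ‖q.1‖ + |q.2| ^ ((1 : ℝ) / 2) ∧ ‖q.1‖ + |q.2| ^ ((1 : ℝ) / 2) < 2) →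
      FT1 (⇑φ) q = 0
  ft_sum : ∀ q : Rn1 n, q ≠ 0 →
    ∑' i : ℤ, FT1 (⇑φ) (((2 : ℝ) ^ (-i)) • q.1, ((2 : ℝ) ^ (-(2 * i))) * q.2) = 1
  ft_psi : ∀ q : Rn1 n,
    FT1 (⇑ψ) q =
      1 - ∑' i : ℕ,
        FT1 (⇑φ) (((2 : ℝ) ^ (-((i : ℤ) + 1))) • q.1, ((2 : ℝ) ^ (-(2 * ((i : ℤ) + 1)))) * q.2)

/-- The dilate `φ_i`, whose Fourier transform is `𝓕φ(2^{−i}ξ, 2^{−2i}τ)`. -/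
def lpPhi {n : ℕ} (P : ParabolicLP n) (i : ℕ) : Rn1 n → ℂ :=
  fun x => (((2 : ℝ) ^ (i * (n + 2)) : ℝ) : ℂ) *
    P.φ (((2 : ℝ) ^ i) • x.1, ((2 : ℝ) ^ (2 * i)) * x.2)

/-- Parabolic Besov norm `N_{s,p}(f)` on `ℝ^{n+1}`, `1 ≤ p < ∞`. -/
def pBesov {n : ℕ} (P : ParabolicLP n) (s p : ℝ) (f : Rn1 n → ℂ) : ℝ≥0∞ :=
  eLpNorm (conv1 (⇑P.ψ) f) (ENNReal.ofReal p) volume +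
  (∑' i : ℕ,
    (ENNReal.ofReal ((2 : ℝ) ^ (s * ((i : ℝ) + 1))) *
      eLpNorm (conv1 (lpPhi P (i + 1)) f) (ENNReal.ofReal p) volume) ^ p) ^ (1 / p)

/-- Parabolic Besov norm `N_{s,∞}(f)` on `ℝ^{n+1}`. -/
def pBesovInf {n : ℕ} (P : ParabolicLP n) (s : ℝ) (f : Rn1 n → ℂ) : ℝ≥0∞ :=
  max (eLpNorm (conv1 (⇑P.ψ) f) ⊤ volume)
    (⨆ i : ℕ, ENNReal.ofReal ((2 : ℝ) ^ (s * ((i : ℝ) + 1))) *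
      eLpNorm (conv1 (lpPhi P (i + 1)) f) ⊤ volume)

/-- The time interval `(0, T)` for `0 < T ≤ ∞`. -/
def tSet (T : ℝ≥0∞) : Set ℝ := {t : ℝ | 0 < t ∧ ENNReal.ofReal t < T}

/-- Lebesgue measure restricted to the strip `ℝⁿ × (0,T)`. -/
def stripMeasure (n : ℕ) (T : ℝ≥0∞) : Measure (Rn1 n) :=
  volume.restrict {x : Rn1 n | x.2 ∈ tSet T}

/-- The parabolic Sobolev norm `‖g‖_{W^{2i,i}_p(ℝⁿ_T)}`. -/
def wNorm {n : ℕ} (i : ℕ) (p : ℝ) (T : ℝ≥0∞) (g : Rn1 n → ℂ) : ℝ≥0∞ :=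
  ∑ l ∈ Finset.range (i + 1),
    ∑ β ∈ (Fintype.piFinset fun _ : Fin n => Finset.range (2 * i + 1)).filter
        (fun β => (∑ k, β k) + 2 * l ≤ 2 * i),
      eLpNorm (dXmulti β (dT^[l] g)) (ENNReal.ofReal p) (stripMeasure n T)

/-- Time-regularity seminorm `[g]_{t,β,p,T}`. -/
def semT {n : ℕ} (b p : ℝ) (T : ℝ≥0∞) (g : Rn1 n → ℂ) : ℝ≥0∞ :=
  (∫⁻ X : Rn n, ∫⁻ t in tSet T, ∫⁻ s in tSet T,
      ENNReal.ofReal (‖g (X, t) - g (X, s)‖ ^ p / |t - s| ^ (1 + p * b / 2))) ^ (1 / p)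

/-- Space-regularity seminorm `[g]_{x,β,p,T}`. -/
def semX {n : ℕ} (b p : ℝ) (T : ℝ≥0∞) (g : Rn1 n → ℂ) : ℝ≥0∞ :=
  (∫⁻ t in tSet T, ∫⁻ X : Rn n, ∫⁻ Y : Rn n,
      ENNReal.ofReal (‖g (X + Y, t) - 2 * g (X, t) + g (X - Y, t)‖ ^ p /
        ‖Y‖ ^ ((n : ℝ) + p * b))) ^ (1 / p)

/-- The parabolic Besov norm `‖g‖_{B^{α,α/2}_p(ℝⁿ_T)}`, formed with index `i` where
`2i < α < 2i+2`. -/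
def pbNorm {n : ℕ} (i : ℕ) (α p : ℝ) (T : ℝ≥0∞) (g : Rn1 n → ℂ) : ℝ≥0∞ :=
  wNorm i p T g +
  ∑ l ∈ Finset.range (i + 1),
    ∑ β ∈ (Fintype.piFinset fun _ : Fin n => Finset.range (2 * i + 1)).filter
        (fun β => (∑ k, β k) + 2 * l = 2 * i),
      (semT (α - 2 * i) p T (dXmulti β (dT^[l] g)) +
        semX (α - 2 * i) p T (dXmulti β (dT^[l] g)))

/-- Fourier transform on `ℝⁿ`. -/
def FTn {n : ℕ} (f : Rn n → ℂ) (ξ : Rn n) : ℂ :=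
  ∫ x : Rn n, Complex.exp (-(2 * (π : ℂ) * Complex.I) * (((∑ k, x k * ξ k : ℝ)) : ℂ)) * f x

/-- Inverse Fourier transform on `ℝⁿ`. -/
def IFTn {n : ℕ} (f : Rn n → ℂ) (x : Rn n) : ℂ :=
  ∫ ξ : Rn n, Complex.exp ((2 * (π : ℂ) * Complex.I) * (((∑ k, ξ k * x k : ℝ)) : ℂ)) * f ξ

/-- Convolution on `ℝⁿ`. -/
def convn {n : ℕ} (g f : Rn n → ℂ) : Rn n → ℂ := fun x => ∫ y : Rn n, g (x - y) * f y

/-- A Littlewood–Paley family on `ℝⁿ`. -/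
structure LPFamily (n : ℕ) where
  φ : SchwartzMap (Rn n) ℂ
  ψ : SchwartzMap (Rn n) ℂ
  ft_pos : ∀ ξ : Rn n, 1 / 2 < ‖ξ‖ → ‖ξ‖ < 2 →
    0 < (FTn (⇑φ) ξ).re ∧ (FTn (⇑φ) ξ).im = 0
  ft_supp : ∀ ξ : Rn n, ¬(1 / 2 < ‖ξ‖ ∧ ‖ξ‖ < 2) → FTn (⇑φ) ξ = 0
  ft_sum : ∀ ξ : Rn n, ξ ≠ 0 → ∑' i : ℤ, FTn (⇑φ) (((2 : ℝ) ^ (-i)) • ξ) = 1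
  ft_psi : ∀ ξ : Rn n,
    FTn (⇑ψ) ξ = 1 - ∑' i : ℕ, FTn (⇑φ) (((2 : ℝ) ^ (-((i : ℤ) + 1))) • ξ)

/-- The dilate `φ′_i(x) = 2^{in} φ′(2^i x)`. -/
def lpPhin {n : ℕ} (P : LPFamily n) (i : ℕ) : Rn n → ℂ :=
  fun x => (((2 : ℝ) ^ (i * n) : ℝ) : ℂ) * P.φ (((2 : ℝ) ^ i) • x)

/-- Besov norm `B_{s,p}(f)` on `ℝⁿ`, `1 ≤ p < ∞`. -/
def besovN {n : ℕ} (P : LPFamily n) (s p : ℝ) (f : Rn n → ℂ) : ℝ≥0∞ :=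
  eLpNorm (convn (⇑P.ψ) f) (ENNReal.ofReal p) volume +
  (∑' i : ℕ,
    (ENNReal.ofReal ((2 : ℝ) ^ (s * ((i : ℝ) + 1))) *
      eLpNorm (convn (lpPhin P (i + 1)) f) (ENNReal.ofReal p) volume) ^ p) ^ (1 / p)

/-- The heat kernel `Γ(X,t)` on `ℝⁿ` (zero for `t ≤ 0`). -/
def heatKer (n : ℕ) (X : Rn n) (t : ℝ) : ℝ :=
  if 0 < t then (4 * π * t) ^ (-(n : ℝ) / 2) * Real.exp (-‖X‖ ^ 2 / (4 * t)) else 0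

/-- The heat extension `u(X,t) = ∫ Γ(X−Y,t) f(Y) dY`. -/
def heatExt {n : ℕ} (f : Rn n → ℂ) : Rn1 n → ℂ :=
  fun x => ∫ Y : Rn n, (heatKer n (x.1 - Y) x.2 : ℂ) * f Y

open scoped FourierTransform SchwartzMap LineDeriv

/-! ### The Fourier transform on Schwartz functions of `Rn1 n` -/

/-- The bilinear pairing `X·ξ + tτ` on `ℝ^{n+1}`. -/
def pairing {n : ℕ} (p q : Rn1 n) : ℝ := (∑ k, p.1 k * q.1 k) + p.2 * q.2

/-- The Hilbert space model of `ℝ^{n+1}`. -/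
abbrev hilbertEquiv (n : ℕ) : WithLp 2 (Rn n × ℝ) ≃L[ℝ] Rn1 n :=
  WithLp.prodContinuousLinearEquiv 2 ℝ (Rn n) ℝ

lemma integral_comp_hilbertEquiv {n : ℕ} (F : Rn1 n → ℂ) :
    ∫ v, F (hilbertEquiv n v) = ∫ p, F p :=
  MeasurePreserving.integral_comp (WithLp.volume_preserving_ofLp (Rn n) ℝ)
    (hilbertEquiv n).toHomeomorph.measurableEmbedding F

lemma inner_hilbertEquiv {n : ℕ} (v w : WithLp 2 (Rn n × ℝ)) :
    inner ℝ v w = pairing (hilbertEquiv n v) (hilbertEquiv n w) := by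
  simp [pairing, WithLp.prod_inner_apply, PiLp.inner_apply, mul_comm]

lemma FT1_hilbertEquiv {n : ℕ} (f : Rn1 n → ℂ) (w : WithLp 2 (Rn n × ℝ)) :
    FT1 f (hilbertEquiv n w) = 𝓕 (f ∘ hilbertEquiv n) w := by
  rw [Real.fourier_eq', FT1, ← integral_comp_hilbertEquiv]
  congr 1
  ext v
  rw [inner_hilbertEquiv, pairing, smul_eq_mul, Function.comp]
  congr 2
  push_cast
  ring

lemma IFT1_hilbertEquiv {n : ℕ} (f : Rn1 n → ℂ) (w : WithLp 2 (Rn n × ℝ)) :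
    IFT1 f (hilbertEquiv n w) = 𝓕⁻ (f ∘ hilbertEquiv n) w := by
  rw [Real.fourierInv_eq', IFT1, ← integral_comp_hilbertEquiv]
  congr 1
  ext v
  rw [inner_hilbertEquiv, pairing, smul_eq_mul, Function.comp]
  congr 2
  push_cast
  ring

/-- `FT1` as a map of Schwartz functions. -/
def schwartzFT {n : ℕ} (f : 𝓢(Rn1 n, ℂ)) : 𝓢(Rn1 n, ℂ) :=
  SchwartzMap.compCLMOfContinuousLinearEquiv ℂ (hilbertEquiv n).symm
    (𝓕 (SchwartzMap.compCLMOfContinuousLinearEquiv ℂ (hilbertEquiv n) f))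

/-- `IFT1` as a map of Schwartz functions. -/
def schwartzIFT {n : ℕ} (f : 𝓢(Rn1 n, ℂ)) : 𝓢(Rn1 n, ℂ) :=
  SchwartzMap.compCLMOfContinuousLinearEquiv ℂ (hilbertEquiv n).symm
    (𝓕⁻ (SchwartzMap.compCLMOfContinuousLinearEquiv ℂ (hilbertEquiv n) f))

lemma coe_schwartzFT {n : ℕ} (f : 𝓢(Rn1 n, ℂ)) : ⇑(schwartzFT f) = FT1 f := by
  ext q
  obtain ⟨w, rfl⟩ := (hilbertEquiv n).surjective q
  rw [FT1_hilbertEquiv]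
  simp [schwartzFT, SchwartzMap.fourier_coe]

lemma coe_schwartzIFT {n : ℕ} (f : 𝓢(Rn1 n, ℂ)) : ⇑(schwartzIFT f) = IFT1 f := by
  ext q
  obtain ⟨w, rfl⟩ := (hilbertEquiv n).surjective q
  rw [IFT1_hilbertEquiv]
  simp [schwartzIFT, SchwartzMap.fourierInv_coe]

lemma IFT1_FT1 {n : ℕ} (f : 𝓢(Rn1 n, ℂ)) : IFT1 (FT1 f) = f := by
  rw [← coe_schwartzFT, ← coe_schwartzIFT]
  ext q
  simp only [schwartzIFT, schwartzFT, SchwartzMap.compCLMOfContinuousLinearEquiv_apply,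
    Function.comp]
  have : SchwartzMap.compCLMOfContinuousLinearEquiv ℂ (hilbertEquiv n)
      (SchwartzMap.compCLMOfContinuousLinearEquiv ℂ (hilbertEquiv n).symm
        (𝓕 (SchwartzMap.compCLMOfContinuousLinearEquiv ℂ (hilbertEquiv n) f)))
      = 𝓕 (SchwartzMap.compCLMOfContinuousLinearEquiv ℂ (hilbertEquiv n) f) := by
    ext; simp
  rw [this, FourierTransform.fourierInv_fourier_eq]
  simp

lemma FT1_schwartzIFT {n : ℕ} (f : 𝓢(Rn1 n, ℂ)) : FT1 (schwartzIFT f) = f := by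
  rw [← coe_schwartzFT]
  ext q
  simp only [schwartzIFT, schwartzFT, SchwartzMap.compCLMOfContinuousLinearEquiv_apply,
    Function.comp]
  have : SchwartzMap.compCLMOfContinuousLinearEquiv ℂ (hilbertEquiv n)
      (SchwartzMap.compCLMOfContinuousLinearEquiv ℂ (hilbertEquiv n).symm
        (𝓕⁻ (SchwartzMap.compCLMOfContinuousLinearEquiv ℂ (hilbertEquiv n) f)))
      = 𝓕⁻ (SchwartzMap.compCLMOfContinuousLinearEquiv ℂ (hilbertEquiv n) f) := by
    ext; simp
  rw [this, FourierTransform.fourier_fourierInv_eq]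
  simp

lemma dX_eq_lineDerivOp {n : ℕ} (k : Fin n) (f : 𝓢(Rn1 n, ℂ)) :
    dX k f = ∂_{((EuclideanSpace.single k 1, 0) : Rn1 n)} f := by
  ext x
  rw [SchwartzMap.lineDerivOp_apply_eq_fderiv, dX]

lemma FT1_dX {n : ℕ} (k : Fin n) (f : 𝓢(Rn1 n, ℂ)) (q : Rn1 n) :
    FT1 (dX k f) q = (2 * π * I * q.1 k) * FT1 f q := by
  obtain ⟨w, rfl⟩ := (hilbertEquiv n).surjective q
  rw [FT1_hilbertEquiv, FT1_hilbertEquiv, dX_eq_lineDerivOp]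
  have h := SchwartzMap.fourier_lineDerivOp_eq
    (SchwartzMap.compCLMOfContinuousLinearEquiv ℂ (hilbertEquiv n) f)
    ((hilbertEquiv n).symm (EuclideanSpace.single k 1, 0))
  rw [SchwartzMap.lineDerivOp_compCLMOfContinuousLinearEquiv] at h
  have h2 := congrArg (fun F : 𝓢(WithLp 2 (Rn n × ℝ), ℂ) => F w) h
  have ht : (fun x : WithLp 2 (Rn n × ℝ) =>
      inner ℝ x ((hilbertEquiv n).symm (EuclideanSpace.single k 1, 0))).HasTemperateGrowth :=
    ((innerSL ℝ).flip _).hasTemperateGrowth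
  simp only [smul_apply, SchwartzMap.smulLeftCLM_apply_apply ht] at h2
  simp only [SchwartzMap.fourier_coe, inner_hilbertEquiv, pairing,
    ContinuousLinearEquiv.apply_symm_apply,
    SchwartzMap.compCLMOfContinuousLinearEquiv_apply] at h2
  rw [h2]
  simp
  ring

/-! ### Convolutions and Fourier multipliers -/

instance isAddHaarMeasure_volume_Rn1 (n : ℕ) : (volume : Measure (Rn1 n)).IsAddHaarMeasure :=
  inferInstanceAs ((volume : Measure (Rn n)).prod (volume : Measure ℝ)).IsAddHaarMeasure

lemma continuous_pairing {n : ℕ} : Continuous (fun z : Rn1 n × Rn1 n => pairing z.1 z.2) := by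
  unfold pairing
  fun_prop

lemma pairing_sub_left {n : ℕ} (x y q : Rn1 n) :
    pairing (x - y) q = pairing x q - pairing y q := by
  simp only [pairing, Prod.fst_sub, Prod.snd_sub, PiLp.sub_apply, sub_mul,
    Finset.sum_sub_distrib]
  ring

lemma pairing_add_left {n : ℕ} (x y q : Rn1 n) :
    pairing (x + y) q = pairing x q + pairing y q := by
  simp only [pairing, Prod.fst_add, Prod.snd_add, PiLp.add_apply, add_mul,
    Finset.sum_add_distrib]
  ring

lemma pairing_comm {n : ℕ} (x y : Rn1 n) : pairing x y = pairing y x := by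
  simp only [pairing, mul_comm]

/-- The character `s ↦ e^{2πis}`. -/
def echar (s : ℝ) : ℂ := Complex.exp (2 * (π : ℂ) * I * (s : ℂ))

lemma continuous_echar : Continuous echar := by
  unfold echar
  fun_prop

lemma echar_add (s t : ℝ) : echar (s + t) = echar s * echar t := by
  rw [echar, echar, echar, ← Complex.exp_add]
  push_cast
  ring_nf

lemma echar_zero : echar 0 = 1 := by simp [echar]

lemma norm_echar (s : ℝ) : ‖echar s‖ = 1 := by
  rw [echar, show 2 * (π : ℂ) * I * (s : ℂ) = ((2 * π * s : ℝ) : ℂ) * I by push_cast; ring]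
  exact Complex.norm_exp_ofReal_mul_I _

lemma FT1_eq {n : ℕ} (f : Rn1 n → ℂ) (q : Rn1 n) :
    FT1 f q = ∫ p, echar (-pairing p q) * f p := by
  simp only [FT1, echar, pairing, Complex.ofReal_neg, mul_neg, neg_mul]

lemma IFT1_eq {n : ℕ} (f : Rn1 n → ℂ) (x : Rn1 n) :
    IFT1 f x = ∫ q, echar (pairing q x) * f q := rfl

lemma integrable_echar_mul {X : Type*} [TopologicalSpace X] [MeasurableSpace X] [BorelSpace X]
    [SecondCountableTopologyEither X ℂ] {μ : Measure X} {f : X → ℂ} (hf : Integrable f μ)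
    {s : X → ℝ} (hs : Continuous s) : Integrable (fun x => echar (s x) * f x) μ :=
  hf.bdd_mul (continuous_echar.comp hs).aestronglyMeasurable (c := 1)
    (Filter.Eventually.of_forall fun _ => (norm_echar _).le)

lemma aestronglyMeasurable_IFT1 {n : ℕ} {G : Rn1 n → ℂ} (hG : Integrable G) :
    AEStronglyMeasurable (IFT1 G) := by
  have h : AEStronglyMeasurable (fun z : Rn1 n × Rn1 n => echar (pairing z.2 z.1) * G z.2)
      (volume.prod volume) :=
    (continuous_echar.comp (continuous_pairing.comp continuous_swap)).aestronglyMeasurable.mul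
      hG.aestronglyMeasurable.comp_snd
  exact h.integral_prod_right'

lemma conv1_IFT1 {n : ℕ} {K G : Rn1 n → ℂ} (hK : Integrable K) (hG : Integrable G) :
    conv1 K (IFT1 G) = IFT1 (fun q => FT1 K q * G q) := by
  ext x
  have hKx : Integrable (fun y => K (x - y)) := hK.comp_sub_left x
  have hprod : Integrable (fun z : Rn1 n × Rn1 n =>
      echar (pairing z.2 z.1) * (K (x - z.1) * G z.2)) (volume.prod volume) :=
    integrable_echar_mul (hKx.mul_prod hG) (continuous_pairing.comp continuous_swap)
  calc conv1 K (IFT1 G) x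
      = ∫ y, ∫ q, echar (pairing q y) * (K (x - y) * G q) := by
        simp only [conv1, IFT1_eq, ← integral_const_mul]
        congr 1; ext y; congr 1; ext q; ring
    _ = ∫ q, ∫ y, echar (pairing q y) * (K (x - y) * G q) := integral_integral_swap hprod
    _ = IFT1 (fun q => FT1 K q * G q) x := by
        rw [IFT1_eq]
        congr 1; ext q
        rw [FT1_eq, ← integral_mul_const, ← integral_const_mul,
          ← integral_sub_left_eq_self _ volume x]
        congr 1; ext y
        rw [sub_sub_cancel, pairing_comm q (x - y), pairing_sub_left, sub_eq_add_neg, echar_add,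
          pairing_comm x q]
        ring

lemma FT1_conv1 {n : ℕ} {K S : Rn1 n → ℂ} (hK : Integrable K) (hS : Integrable S) :
    Integrable (conv1 K S) ∧ FT1 (conv1 K S) = fun q => FT1 K q * FT1 S q := by
  have hconv : ∀ K S : Rn1 n → ℂ,
      conv1 K S = convolution S K (ContinuousLinearMap.mul ℝ ℂ) volume := by
    intro K S
    ext x
    simp only [conv1, convolution, ContinuousLinearMap.mul_apply', mul_comm]
  refine ⟨by rw [hconv]; exact hS.integrable_convolution _ hK, ?_⟩
  ext q
  have hc : Continuous (fun p : Rn1 n => -pairing p q) :=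
    (continuous_pairing.comp (Continuous.prodMk_left q)).neg
  have h := integral_convolution (ContinuousLinearMap.mul ℝ ℂ) (integrable_echar_mul hS hc)
    (integrable_echar_mul hK hc)
  rw [← hconv] at h
  rw [FT1_eq, FT1_eq, FT1_eq, mul_comm, ← ContinuousLinearMap.mul_apply' ℝ, ← h]
  congr 1; ext x
  rw [conv1, conv1, ← integral_const_mul]
  congr 1; ext y
  rw [pairing_sub_left,
    show -pairing x q = -(pairing x q - pairing y q) + -pairing y q by ring, echar_add]
  ring

/-- A weighted Jensen inequality. -/
lemma lintegral_mul_rpow_le {X : Type*} [MeasurableSpace X] {μ : Measure X} {a b : X → ℝ≥0∞}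
    (ha : AEMeasurable a μ) (hb : AEMeasurable b μ) {p : ℝ} (hp : 1 ≤ p) :
    (∫⁻ x, a x * b x ∂μ) ^ p ≤ (∫⁻ x, a x ∂μ) ^ (p - 1) * ∫⁻ x, a x * b x ^ p ∂μ := by
  have hp0 : 0 < p := by linarith
  have hinv : 0 ≤ 1 - 1 / p := by
    rw [sub_nonneg, div_le_one hp0]; exact hp
  have h := ENNReal.lintegral_mul_norm_pow_le ha (ha.mul (hb.pow_const p)) hinv
    (by positivity : 0 ≤ 1 / p) (by ring)
  have h2 : (∫⁻ x, a x * b x ∂μ) ≤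
      (∫⁻ x, a x ∂μ) ^ (1 - 1 / p) * (∫⁻ x, a x * b x ^ p ∂μ) ^ (1 / p) := by
    refine le_trans (lintegral_mono fun x => le_of_eq ?_) h
    simp only [Pi.mul_apply]
    rw [ENNReal.mul_rpow_of_nonneg _ _ (by positivity), ← mul_assoc,
      ← ENNReal.rpow_add_of_nonneg _ _ hinv (by positivity), ← ENNReal.rpow_mul,
      mul_one_div_cancel hp0.ne', sub_add_cancel, ENNReal.rpow_one, ENNReal.rpow_one]
  calc (∫⁻ x, a x * b x ∂μ) ^ p
      ≤ ((∫⁻ x, a x ∂μ) ^ (1 - 1 / p) * (∫⁻ x, a x * b x ^ p ∂μ) ^ (1 / p)) ^ p :=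
        ENNReal.rpow_le_rpow h2 hp0.le
    _ = _ := by
        rw [ENNReal.mul_rpow_of_nonneg _ _ hp0.le, ← ENNReal.rpow_mul, ← ENNReal.rpow_mul,
          one_div_mul_cancel hp0.ne', ENNReal.rpow_one]
        congr 2
        field_simp

/-- Young's inequality `L¹ * Lᵖ ⊆ Lᵖ`. -/
lemma eLpNorm_conv1_le {n : ℕ} {K g : Rn1 n → ℂ} (hK : AEStronglyMeasurable K)
    (hg : AEStronglyMeasurable g) {p : ℝ} (hp : 1 ≤ p) :
    eLpNorm (conv1 K g) (ENNReal.ofReal p) volume ≤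
      (∫⁻ x, ‖K x‖ₑ) * eLpNorm g (ENNReal.ofReal p) volume := by
  have hp0 : 0 < p := by linarith
  have hpne : ENNReal.ofReal p ≠ 0 := by simpa using hp0
  rw [eLpNorm_eq_lintegral_rpow_enorm_toReal hpne ENNReal.ofReal_ne_top,
    eLpNorm_eq_lintegral_rpow_enorm_toReal hpne ENNReal.ofReal_ne_top,
    ENNReal.toReal_ofReal hp0.le]
  set A := ∫⁻ x, ‖K x‖ₑ with hA
  have hKs : ∀ x, AEMeasurable (fun y => ‖K (x - y)‖ₑ) := fun x =>
    (hK.comp_quasiMeasurePreserving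
      (quasiMeasurePreserving_sub_left volume x)).enorm
  have key : ∫⁻ x, ‖conv1 K g x‖ₑ ^ p ≤ A ^ p * ∫⁻ y, ‖g y‖ₑ ^ p := by
    calc ∫⁻ x, ‖conv1 K g x‖ₑ ^ p
        ≤ ∫⁻ x, A ^ (p - 1) * ∫⁻ y, ‖K (x - y)‖ₑ * ‖g y‖ₑ ^ p := by
          refine lintegral_mono fun x => ?_
          refine le_trans (ENNReal.rpow_le_rpow (enorm_integral_le_lintegral_enorm _) hp0.le) ?_
          simp only [enorm_mul]
          refine (lintegral_mul_rpow_le (hKs x) hg.enorm hp).trans_eq ?_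
          rw [hA, lintegral_sub_left_eq_self (fun y => ‖K y‖ₑ) x]
      _ = A ^ (p - 1) * ∫⁻ x, ∫⁻ y, ‖K (x - y)‖ₑ * ‖g y‖ₑ ^ p := by
          refine lintegral_const_mul'' _ ?_
          refine AEMeasurable.lintegral_prod_right' (f := fun z : Rn1 n × Rn1 n =>
            ‖K (z.1 - z.2)‖ₑ * ‖g z.2‖ₑ ^ p) ?_
          exact (hK.comp_quasiMeasurePreserving
            (quasiMeasurePreserving_sub volume volume)).enorm.mul
              (hg.comp_snd.enorm.pow_const p)
      _ = A ^ (p - 1) * ∫⁻ y, ∫⁻ x, ‖K (x - y)‖ₑ * ‖g y‖ₑ ^ p := by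
          rw [lintegral_lintegral_swap]
          exact (hK.comp_quasiMeasurePreserving
            (quasiMeasurePreserving_sub volume volume)).enorm.mul
              (hg.comp_snd.enorm.pow_const p)
      _ = A ^ (p - 1) * ∫⁻ y, A * ‖g y‖ₑ ^ p := by
          congr 1
          refine lintegral_congr fun y => ?_
          have hKy : AEMeasurable (fun x => ‖K (x - y)‖ₑ) := (hK.comp_quasiMeasurePreserving
            (measurePreserving_sub_right volume y).quasiMeasurePreserving).enorm
          rw [lintegral_mul_const'' _ hKy,
            lintegral_sub_right_eq_self (fun x => ‖K x‖ₑ) y]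
      _ = A ^ p * ∫⁻ y, ‖g y‖ₑ ^ p := by
          rw [lintegral_const_mul'' _ (hg.enorm.pow_const p), ← mul_assoc]
          congr 1
          nth_rewrite 2 [← ENNReal.rpow_one A]
          rw [← ENNReal.rpow_add_of_nonneg _ _ (by linarith) zero_le_one, sub_add_cancel]
  calc (∫⁻ x, ‖conv1 K g x‖ₑ ^ p) ^ (1 / p)
      ≤ (A ^ p * ∫⁻ y, ‖g y‖ₑ ^ p) ^ (1 / p) := ENNReal.rpow_le_rpow key (by positivity)
    _ = _ := by
        rw [ENNReal.mul_rpow_of_nonneg _ _ (by positivity), ← ENNReal.rpow_mul,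
          mul_one_div_cancel hp0.ne', ENNReal.rpow_one]

/-! ### Parabolic dilations -/

/-- The parabolic dilation `(X,t) ↦ (rX, r²t)`. -/
def parScale {n : ℕ} (r : ℝ) (x : Rn1 n) : Rn1 n := (r • x.1, r ^ 2 * x.2)

/-- The `L¹`-normalized parabolic dilate of a kernel. -/
def parDilate {n : ℕ} (r : ℝ) (K : Rn1 n → ℂ) : Rn1 n → ℂ :=
  fun x => ((r ^ (n + 2) : ℝ) : ℂ) * K (parScale r x)

lemma parScale_inv {n : ℕ} {r : ℝ} (hr : 0 < r) (x : Rn1 n) :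
    parScale r⁻¹ (parScale r x) = x := by
  ext <;> simp [parScale, hr.ne']

lemma parScale_inv' {n : ℕ} {r : ℝ} (hr : 0 < r) (x : Rn1 n) :
    parScale r (parScale r⁻¹ x) = x := by
  ext <;> simp [parScale, hr.ne']

lemma continuous_parScale {n : ℕ} (r : ℝ) : Continuous (parScale (n := n) r) := by
  unfold parScale; fun_prop

lemma measurableEmbedding_parScale {n : ℕ} {r : ℝ} (hr : 0 < r) :
    MeasurableEmbedding (parScale (n := n) r) :=
  Homeomorph.measurableEmbedding
    { toFun := parScale r
      invFun := parScale r⁻¹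
      left_inv := parScale_inv hr
      right_inv := parScale_inv' hr
      continuous_toFun := continuous_parScale r
      continuous_invFun := continuous_parScale r⁻¹ }

lemma map_parScale {n : ℕ} {r : ℝ} (hr : 0 < r) :
    Measure.map (parScale (n := n) r) volume =
      ENNReal.ofReal ((r ^ (n + 2))⁻¹) • volume := by
  have h1 : Measure.map (fun x : Rn n => r • x) volume =
      ENNReal.ofReal ((r ^ n)⁻¹) • volume := by
    rw [Measure.map_addHaar_smul _ hr.ne']
    simp [abs_of_pos hr]
  have h2 : Measure.map (fun x : ℝ => r ^ 2 * x) volume =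
      ENNReal.ofReal ((r ^ 2)⁻¹) • volume := by
    have := Measure.map_addHaar_smul (volume : Measure ℝ) (pow_ne_zero 2 hr.ne')
    simp only [smul_eq_mul] at this
    rw [this]
    simp [abs_of_pos hr]
  have h := Measure.map_prod_map (volume : Measure (Rn n)) (volume : Measure ℝ)
    (f := fun x => r • x) (g := fun x => r ^ 2 * x) (by fun_prop) (by fun_prop)
  rw [h1, h2, Measure.prod_smul_left, Measure.prod_smul_right, smul_smul,
    ← ENNReal.ofReal_mul (by positivity), ← mul_inv, ← pow_add] at h
  exact h.symm

lemma integral_comp_parScale {n : ℕ} {E : Type*} [NormedAddCommGroup E] [NormedSpace ℝ E]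
    {r : ℝ} (hr : 0 < r) (F : Rn1 n → E) :
    ∫ x, F (parScale r x) = (r ^ (n + 2))⁻¹ • ∫ x, F x := by
  rw [← (measurableEmbedding_parScale hr).integral_map, map_parScale hr, integral_smul_measure,
    ENNReal.toReal_ofReal (by positivity)]

lemma integrable_parDilate {n : ℕ} {r : ℝ} (hr : 0 < r) {K : Rn1 n → ℂ} (hK : Integrable K) :
    Integrable (parDilate r K) := by
  refine Integrable.const_mul ?_ _
  refine (measurableEmbedding_parScale hr).integrable_map_iff.1 ?_
  rw [map_parScale hr]
  exact hK.smul_measure ENNReal.ofReal_ne_top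

lemma lintegral_parDilate {n : ℕ} {r : ℝ} (hr : 0 < r) {K : Rn1 n → ℂ} (hK : Integrable K) :
    ∫⁻ x, ‖parDilate r K x‖ₑ = ∫⁻ x, ‖K x‖ₑ := by
  rw [← ofReal_integral_norm_eq_lintegral_enorm hK,
    ← ofReal_integral_norm_eq_lintegral_enorm (integrable_parDilate hr hK)]
  congr 1
  simp only [parDilate, norm_mul, integral_const_mul,
    integral_comp_parScale hr (fun x => ‖K x‖), Complex.norm_real, Real.norm_eq_abs,
    abs_of_pos (pow_pos hr (n + 2)), smul_eq_mul]
  field_simp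

lemma pairing_parScale {n : ℕ} (r : ℝ) (p q : Rn1 n) :
    pairing (parScale r p) q = pairing p (parScale r q) := by
  simp only [pairing, parScale, PiLp.smul_apply, smul_eq_mul]
  congr 1
  · exact Finset.sum_congr rfl fun k _ => by ring
  · ring

lemma FT1_parDilate {n : ℕ} {r : ℝ} (hr : 0 < r) (K : Rn1 n → ℂ) (q : Rn1 n) :
    FT1 (parDilate r K) q = FT1 K (parScale r⁻¹ q) := by
  rw [FT1_eq, FT1_eq]
  have h := integral_comp_parScale hr
    (fun p : Rn1 n => ((r ^ (n + 2) : ℝ) : ℂ) * (echar (-pairing p (parScale r⁻¹ q)) * K p))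
  rw [integral_const_mul] at h
  rw [integral_const_mul, Complex.real_smul, ← mul_assoc, ← Complex.ofReal_mul,
    inv_mul_cancel₀ (by positivity), Complex.ofReal_one, one_mul] at h
  rw [← h, ← integral_const_mul]
  refine integral_congr_ae (Filter.Eventually.of_forall fun p => ?_)
  simp only [← pairing_parScale r⁻¹, parScale_inv hr, parDilate]
  ring

lemma lpPhi_eq {n : ℕ} (P : ParabolicLP n) (i : ℕ) :
    lpPhi P i = parDilate ((2 : ℝ) ^ i) P.φ := by
  ext x
  simp only [lpPhi, parDilate, parScale, ← pow_mul, mul_comm 2 i]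

/-! ### The half derivative of a Schwartz function -/

/-- The weight `|h|^{-3/2}`. -/
def halfWeight (h : ℝ) : ℝ := |h| ^ (-(3 : ℝ) / 2)

lemma halfWeight_nonneg (h : ℝ) : 0 ≤ halfWeight h := by unfold halfWeight; positivity

lemma measurable_halfWeight : Measurable halfWeight := by unfold halfWeight; fun_prop

lemma integrable_min_mul_halfWeight : Integrable (fun h : ℝ => min 1 |h| * halfWeight h) := by
  have hpos : IntegrableOn (fun h : ℝ => min 1 |h| * halfWeight h) (Set.Ioi 0) := by
    rw [← Set.Ioc_union_Ioi_eq_Ioi (zero_le_one' ℝ), integrableOn_union]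
    constructor
    · have h1 : IntegrableOn (fun h : ℝ => h ^ (-(1 : ℝ) / 2)) (Set.Ioc 0 1) := by
        have := intervalIntegral.intervalIntegrable_rpow' (a := 0) (b := 1)
          (show (-1 : ℝ) < -(1 : ℝ) / 2 by norm_num)
        rwa [intervalIntegrable_iff_integrableOn_Ioc_of_le zero_le_one] at this
      refine h1.congr_fun (fun h hh => ?_) measurableSet_Ioc
      simp only [halfWeight, abs_of_pos hh.1, min_eq_right hh.2]
      nth_rewrite 2 [← Real.rpow_one h]
      rw [← Real.rpow_add hh.1]
      norm_num
    · have h1 := integrableOn_Ioi_rpow_of_lt (show -(3 : ℝ) / 2 < -1 by norm_num) zero_lt_one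
      refine h1.congr_fun (fun h hh => ?_) measurableSet_Ioi
      have hh' : (1 : ℝ) < h := hh
      simp only [halfWeight, abs_of_pos (zero_lt_one.trans hh'), min_eq_left hh'.le, one_mul]
  have hneg : IntegrableOn (fun h : ℝ => min 1 |h| * halfWeight h) (Set.Iic 0) := by
    have hm : MeasurableEmbedding (Neg.neg : ℝ → ℝ) := (Homeomorph.neg ℝ).measurableEmbedding
    rw [← Measure.map_neg_eq_self (volume : Measure ℝ), hm.integrableOn_map_iff]
    simpa [Function.comp_def, halfWeight, integrableOn_Ici_iff_integrableOn_Ioi] using hpos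
  rw [← integrableOn_univ, ← Set.Iic_union_Ioi (a := (0 : ℝ)), integrableOn_union]
  exact ⟨hneg, hpos⟩

lemma norm_one_sub_echar_le (s : ℝ) : ‖1 - echar s‖ ≤ 2 * π * min 1 |s| := by
  rw [mul_min_of_nonneg _ _ (by positivity), le_min_iff]
  constructor
  · calc ‖1 - echar s‖ ≤ ‖(1 : ℂ)‖ + ‖echar s‖ := norm_sub_le _ _
      _ ≤ 2 * π * 1 := by
        rw [norm_one, norm_echar]
        linarith [Real.pi_gt_three]
  · rw [norm_sub_rev, echar,
      show 2 * (π : ℂ) * I * (s : ℂ) = I * ((2 * π * s : ℝ) : ℂ) by push_cast; ring]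
    refine (Real.norm_exp_I_mul_ofReal_sub_one_le).trans_eq ?_
    rw [Real.norm_eq_abs, abs_mul, abs_of_pos (by positivity : 0 < 2 * π)]

lemma integrable_one_sub_echar_mul_halfWeight :
    Integrable (fun h : ℝ => (1 - echar h) * (halfWeight h : ℂ)) := by
  refine (integrable_min_mul_halfWeight.const_mul (2 * π)).mono' ?_ ?_
  · exact ((continuous_const.sub continuous_echar).measurable.mul
      (Complex.measurable_ofReal.comp measurable_halfWeight)).aestronglyMeasurable
  · refine Filter.Eventually.of_forall fun h => ?_
    rw [norm_mul, Complex.norm_real, Real.norm_eq_abs, abs_of_nonneg (halfWeight_nonneg h),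
      ← mul_assoc]
    exact mul_le_mul_of_nonneg_right (norm_one_sub_echar_le h) (halfWeight_nonneg h)

/-- The normalizing constant `∫ (1 - e^{2πih}) |h|^{-3/2} dh`. -/
def halfConst : ℂ := ∫ h : ℝ, (1 - echar h) * (halfWeight h : ℂ)

lemma halfConst_ne_zero : halfConst ≠ 0 := by
  intro h0
  have hre : ∀ h : ℝ, ((1 - echar h) * (halfWeight h : ℂ)).re =
      (1 - Real.cos (2 * π * h)) * halfWeight h := by
    intro h
    rw [Complex.re_mul_ofReal, Complex.sub_re, Complex.one_re, echar,
      show 2 * (π : ℂ) * I * (h : ℂ) = ((2 * π * h : ℝ) : ℂ) * I by push_cast; ring,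
      Complex.exp_ofReal_mul_I_re]
  have hint : Integrable (fun h : ℝ => (1 - Real.cos (2 * π * h)) * halfWeight h) :=
    integrable_one_sub_echar_mul_halfWeight.re.congr (Filter.Eventually.of_forall hre)
  have hzero : ∫ h : ℝ, (1 - Real.cos (2 * π * h)) * halfWeight h = 0 := by
    simp only [← hre]
    have := integral_re integrable_one_sub_echar_mul_halfWeight
    simp only [RCLike.re_eq_complex_re] at this
    rw [this]
    simpa [halfConst] using congrArg Complex.re h0
  have hnn : 0 ≤ fun h : ℝ => (1 - Real.cos (2 * π * h)) * halfWeight h := fun h =>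
    mul_nonneg (by linarith [Real.cos_le_one (2 * π * h)]) (halfWeight_nonneg h)
  refine hzero.not_gt ((integral_pos_iff_support_of_nonneg hnn hint).2 ?_)
  refine lt_of_lt_of_le ?_ (measure_mono (s := Set.Ioo (0 : ℝ) 1) fun h hh => ?_)
  · simp
  · refine mul_ne_zero (fun hc => ?_) ?_
    · have h1 : Real.cos (2 * π * h - 2 * π) = 1 := by rw [Real.cos_sub_two_pi]; linarith
      have h2 := (Real.cos_eq_one_iff_of_lt_of_lt (by nlinarith [Real.pi_pos, hh.1])
        (by nlinarith [Real.pi_pos, hh.2])).1 h1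
      nlinarith [Real.pi_pos, hh.2]
    · have := hh.1
      rw [halfWeight]
      positivity

lemma integral_one_sub_echar_mul (s : ℝ) :
    ∫ h : ℝ, (1 - echar (h * s)) * (halfWeight h : ℂ) =
      ((|s| ^ ((1 : ℝ) / 2) : ℝ) : ℂ) * halfConst := by
  rcases eq_or_ne s 0 with rfl | hs
  · simp [echar_zero]
  have hs' : 0 < |s| := abs_pos.2 hs
  have h := Measure.integral_comp_mul_left (fun h : ℝ => (1 - echar h) * (halfWeight h : ℂ)) s
  calc ∫ h : ℝ, (1 - echar (h * s)) * (halfWeight h : ℂ)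
      = ∫ h : ℝ, ((|s| ^ ((3 : ℝ) / 2) : ℝ) : ℂ) *
          ((1 - echar (s * h)) * (halfWeight (s * h) : ℂ)) := by
        congr 1; ext h
        have : halfWeight h = |s| ^ ((3 : ℝ) / 2) * halfWeight (s * h) := by
          rw [halfWeight, halfWeight, abs_mul, Real.mul_rpow hs'.le (abs_nonneg h), ← mul_assoc,
            ← Real.rpow_add hs']
          norm_num
        rw [this, mul_comm h s]
        push_cast
        ring
    _ = _ := by
        rw [integral_const_mul, h, ← halfConst, Complex.real_smul, ← mul_assoc,
          ← Complex.ofReal_mul]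
        congr 2
        rw [abs_inv, ← Real.rpow_neg_one, ← Real.rpow_add hs']
        norm_num

/-- Translation in the time variable. -/
lemma FT1_comp_add_time {n : ℕ} (g : Rn1 n → ℂ) (h : ℝ) (q : Rn1 n) :
    FT1 (fun x => g (x + (0, h))) q = echar (h * q.2) * FT1 g q := by
  rw [FT1_eq, FT1_eq, ← integral_const_mul,
    ← integral_add_right_eq_self (fun p => echar (h * q.2) * (echar (-pairing p q) * g p))
      ((0, h) : Rn1 n)]
  congr 1; ext p
  rw [pairing_add_left, ← mul_assoc, ← echar_add]
  congr 2
  simp [pairing]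

lemma integral_norm_sub_time_le {n : ℕ} (g : 𝓢(Rn1 n, ℂ)) :
    ∃ C : ℝ, ∀ h : ℝ, ∫ x : Rn1 n, ‖g x - g (x + (0, h))‖ ≤ C * min 1 |h| := by
  set G : 𝓢(Rn1 n, ℂ) := ∂_{((0, 1) : Rn1 n)} g with hG
  have hGd : ∀ x, G x = fderiv ℝ g x (0, 1) := fun x => SchwartzMap.lineDerivOp_apply_eq_fderiv ..
  have hgi : ∀ h : ℝ, Integrable (fun x : Rn1 n => g (x + (0, h))) := fun h =>
    g.integrable.comp_add_right _
  have h1 : ∀ h : ℝ, ∫ x : Rn1 n, ‖g x - g (x + (0, h))‖ ≤ 2 * ∫ x : Rn1 n, ‖g x‖ := by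
    intro h
    calc ∫ x : Rn1 n, ‖g x - g (x + (0, h))‖
        ≤ ∫ x : Rn1 n, (‖g x‖ + ‖g (x + (0, h))‖) :=
          integral_mono (g.integrable.sub (hgi h)).norm (g.integrable.norm.add (hgi h).norm)
            fun x => norm_sub_le _ _
      _ = 2 * ∫ x : Rn1 n, ‖g x‖ := by
          rw [integral_add g.integrable.norm (hgi h).norm,
            integral_add_right_eq_self (fun x => ‖g x‖), two_mul]
  have h2 : ∀ h : ℝ, ∫ x : Rn1 n, ‖g x - g (x + (0, h))‖ ≤ |h| * ∫ x : Rn1 n, ‖G x‖ := by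
    intro h
    have hpt : ∀ x : Rn1 n,
        ‖g x - g (x + (0, h))‖ₑ ≤ ∫⁻ s in Set.Ioc (0 : ℝ) 1, ‖h * G (x + (0, s * h))‖ₑ := by
      intro x
      have hd : ∀ s ∈ Set.uIcc (0 : ℝ) 1, HasDerivAt (fun s : ℝ => g (x + (0, s * h)))
          (h * G (x + (0, s * h))) s := by
        intro s _
        have hl : HasDerivAt (fun s : ℝ => x + ((0, s * h) : Rn1 n)) (0, h) s := by
          have := ((hasDerivAt_const s (0 : Rn n)).prodMk
            ((hasDerivAt_id s).mul_const h)).const_add x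
          simpa using this
        have := (g.differentiableAt (x := x + (0, s * h))).hasFDerivAt.comp_hasDerivAt s hl
        rwa [show ((0, h) : Rn1 n) = h • (0, 1) by simp, map_smul, Complex.real_smul,
          ← hGd] at this
      have hc : Continuous (fun s : ℝ => (h : ℂ) * G (x + (0, s * h))) := by
        have := G.continuous
        fun_prop
      have hi := intervalIntegral.integral_eq_sub_of_hasDerivAt hd (hc.intervalIntegrable 0 1)
      simp only [one_mul, zero_mul, Prod.mk_zero_zero, add_zero] at hi
      rw [← enorm_neg, neg_sub, ← hi, intervalIntegral.integral_of_le zero_le_one]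
      exact enorm_integral_le_lintegral_enorm _
    have hl : ∫⁻ x : Rn1 n, ‖g x - g (x + (0, h))‖ₑ ≤ ‖h‖ₑ * ∫⁻ x : Rn1 n, ‖G x‖ₑ := by
      calc ∫⁻ x : Rn1 n, ‖g x - g (x + (0, h))‖ₑ
          ≤ ∫⁻ x : Rn1 n, ∫⁻ s in Set.Ioc (0 : ℝ) 1, ‖h * G (x + (0, s * h))‖ₑ :=
            lintegral_mono hpt
        _ = ∫⁻ s in Set.Ioc (0 : ℝ) 1, ∫⁻ x : Rn1 n, ‖h * G (x + (0, s * h))‖ₑ := by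
            refine lintegral_lintegral_swap ?_
            refine Continuous.aemeasurable ?_
            have := G.continuous
            fun_prop
        _ = ∫⁻ s in Set.Ioc (0 : ℝ) 1, ‖h‖ₑ * ∫⁻ x : Rn1 n, ‖G x‖ₑ := by
            refine lintegral_congr fun s => ?_
            rw [lintegral_add_right_eq_self (fun x : Rn1 n => ‖(h : ℂ) * G x‖ₑ)]
            simp only [enorm_mul]
            rw [lintegral_const_mul' _ _ (by simp)]
            congr 1
            simp [← ofReal_norm]
        _ = _ := by simp
    rw [← ofReal_integral_norm_eq_lintegral_enorm
        (f := fun x : Rn1 n => g x - g (x + (0, h))) (g.integrable.sub (hgi h)),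
      ← ofReal_integral_norm_eq_lintegral_enorm G.integrable, ← ofReal_norm,
      ← ENNReal.ofReal_mul (norm_nonneg _), ENNReal.ofReal_le_ofReal_iff (by positivity)] at hl
    exact hl
  refine ⟨max (2 * ∫ x : Rn1 n, ‖g x‖) (∫ x : Rn1 n, ‖G x‖), fun h => ?_⟩
  rcases le_total 1 |h| with hh | hh
  · rw [min_eq_left hh, mul_one]
    exact (h1 h).trans (le_max_left _ _)
  · rw [min_eq_right hh, mul_comm]
    exact (h2 h).trans (mul_le_mul_of_nonneg_left (le_max_right _ _) (abs_nonneg h))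

lemma integrable_sub_time_mul_halfWeight {n : ℕ} (g : 𝓢(Rn1 n, ℂ)) :
    Integrable (fun z : Rn1 n × ℝ => (g z.1 - g (z.1 + (0, z.2))) * (halfWeight z.2 : ℂ))
      (volume.prod volume) := by
  obtain ⟨C, hC⟩ := integral_norm_sub_time_le g
  have hm : Measurable
      (fun z : Rn1 n × ℝ => (g z.1 - g (z.1 + (0, z.2))) * (halfWeight z.2 : ℂ)) := by
    refine Measurable.mul (Continuous.measurable ?_)
      (Complex.measurable_ofReal.comp (measurable_halfWeight.comp measurable_snd))
    have := g.continuous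
    fun_prop
  refine (integrable_prod_iff' hm.aestronglyMeasurable).2 ⟨?_, ?_⟩
  · refine Filter.Eventually.of_forall fun h => ?_
    have hg : Integrable g := g.integrable
    have hs : Integrable (fun x : Rn1 n => g (x + (0, h))) := hg.comp_add_right (0, h)
    exact (hg.sub hs).mul_const (halfWeight h : ℂ)
  · refine (integrable_min_mul_halfWeight.const_mul C).mono'
      (hm.norm.comp measurable_swap).aestronglyMeasurable.integral_prod_right' ?_
    refine Filter.Eventually.of_forall fun h => ?_
    simp only [norm_mul, integral_mul_const, Complex.norm_real, Real.norm_eq_abs,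
      abs_of_nonneg (halfWeight_nonneg h)]
    rw [abs_of_nonneg (integral_nonneg fun _ => norm_nonneg _), ← mul_assoc]
    exact mul_le_mul_of_nonneg_right (hC h) (halfWeight_nonneg h)

/-- `|τ|^{1/2}` times the Fourier transform of a Schwartz function is the Fourier transform of
an integrable function. -/
lemma exists_integrable_FT1_eq_half {n : ℕ} (g : 𝓢(Rn1 n, ℂ)) :
    ∃ K : Rn1 n → ℂ, Integrable K ∧
      FT1 K = fun q => ((|q.2| ^ ((1 : ℝ) / 2) : ℝ) : ℂ) * FT1 g q := by
  have hint := integrable_sub_time_mul_halfWeight g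
  refine ⟨fun x => halfConst⁻¹ * ∫ h : ℝ, (g x - g (x + (0, h))) * (halfWeight h : ℂ),
    hint.integral_prod_left.const_mul _, ?_⟩
  ext q
  have hc : Continuous (fun z : Rn1 n × ℝ => -pairing z.1 q) :=
    (continuous_pairing.comp (continuous_fst.prodMk continuous_const)).neg
  have hcq : Continuous (fun p : Rn1 n => -pairing p q) :=
    (continuous_pairing.comp (Continuous.prodMk_left q)).neg
  calc FT1 (fun x => halfConst⁻¹ * ∫ h : ℝ, (g x - g (x + (0, h))) * (halfWeight h : ℂ)) q
      = halfConst⁻¹ * ∫ x, ∫ h : ℝ,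
          echar (-pairing x q) * ((g x - g (x + (0, h))) * (halfWeight h : ℂ)) := by
        rw [FT1_eq, ← integral_const_mul]
        congr 1; ext x
        rw [integral_const_mul]
        ring
    _ = halfConst⁻¹ * ∫ h : ℝ, ∫ x,
          echar (-pairing x q) * ((g x - g (x + (0, h))) * (halfWeight h : ℂ)) := by
        rw [integral_integral_swap (integrable_echar_mul hint hc)]
    _ = halfConst⁻¹ * ∫ h : ℝ, (1 - echar (h * q.2)) * (halfWeight h : ℂ) * FT1 g q := by
        congr 2; ext h
        have h1 := integrable_echar_mul (g.integrable (μ := volume)) hcq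
        have h2 := integrable_echar_mul ((g.integrable (μ := volume)).comp_add_right ((0, h) : Rn1 n)) hcq
        have h3 := FT1_comp_add_time g h q
        rw [FT1_eq] at h3
        simp only [← mul_assoc, integral_mul_const, mul_sub]
        rw [integral_sub h1 h2, h3, ← FT1_eq]
        ring
    _ = _ := by
        rw [integral_mul_const, integral_one_sub_echar_mul]
        field_simp [halfConst_ne_zero]

/-! ### Symbols of first parabolic order -/

/-- `m` is the Fourier transform of an integrable function. -/
def IsL1Symbol {n : ℕ} (m : Rn1 n → ℂ) : Prop := ∃ K : Rn1 n → ℂ, Integrable K ∧ FT1 K = m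

lemma IsL1Symbol.mul {n : ℕ} {m₁ m₂ : Rn1 n → ℂ} (h₁ : IsL1Symbol m₁) (h₂ : IsL1Symbol m₂) :
    IsL1Symbol (fun q => m₁ q * m₂ q) := by
  obtain ⟨K₁, hK₁, rfl⟩ := h₁
  obtain ⟨K₂, hK₂, rfl⟩ := h₂
  exact ⟨conv1 K₁ K₂, FT1_conv1 hK₁ hK₂⟩

lemma isL1Symbol_schwartz {n : ℕ} (f : 𝓢(Rn1 n, ℂ)) : IsL1Symbol f :=
  ⟨schwartzIFT f, (schwartzIFT f).integrable, FT1_schwartzIFT f⟩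

lemma isL1Symbol_half_mul {n : ℕ} (f : 𝓢(Rn1 n, ℂ)) :
    IsL1Symbol (fun q => ((|q.2| ^ ((1 : ℝ) / 2) : ℝ) : ℂ) * f q) := by
  have h := exists_integrable_FT1_eq_half (schwartzIFT f)
  rwa [FT1_schwartzIFT] at h

/-- The symbols of `D_t^{1/2}` and of the derivatives `∂_{X_k}`. -/
def firstSymbol {n : ℕ} : Option (Fin n) → Rn1 n → ℂ
  | none, q => ((|q.2| ^ ((1 : ℝ) / 2) : ℝ) : ℂ)
  | some k, q => 2 * π * I * q.1 k

/-- The parabolic size `|ξ| + |τ|^{1/2}`. -/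
def parNorm {n : ℕ} (q : Rn1 n) : ℝ := ‖q.1‖ + |q.2| ^ ((1 : ℝ) / 2)

lemma half_abs_parScale {n : ℕ} {r : ℝ} (hr : 0 < r) (q : Rn1 n) :
    |(parScale r q).2| ^ ((1 : ℝ) / 2) = r * |q.2| ^ ((1 : ℝ) / 2) := by
  rw [parScale, abs_mul, abs_of_pos (pow_pos hr 2), Real.mul_rpow (by positivity) (abs_nonneg _),
    ← Real.sqrt_eq_rpow, Real.sqrt_sq hr.le]

lemma parNorm_parScale {n : ℕ} {r : ℝ} (hr : 0 < r) (q : Rn1 n) :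
    parNorm (parScale r q) = r * parNorm q := by
  rw [parNorm, half_abs_parScale hr, parNorm, parScale, norm_smul, Real.norm_eq_abs,
    abs_of_pos hr, mul_add]

lemma firstSymbol_parScale {n : ℕ} {r : ℝ} (hr : 0 < r) (o : Option (Fin n)) (q : Rn1 n) :
    firstSymbol o (parScale r q) = r * firstSymbol o q := by
  cases o with
  | none => rw [firstSymbol, half_abs_parScale hr, firstSymbol, Complex.ofReal_mul]
  | some k =>
    simp only [firstSymbol, parScale, PiLp.smul_apply, smul_eq_mul, Complex.ofReal_mul]
    ring

lemma abs_snd_eq_sq {n : ℕ} (q : Rn1 n) : |q.2| = (|q.2| ^ ((1 : ℝ) / 2)) ^ 2 := by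
  rw [← Real.sqrt_eq_rpow, Real.sq_sqrt (abs_nonneg _)]

lemma norm_le_of_parNorm_le {n : ℕ} {q : Rn1 n} (hq : parNorm q ≤ 2) : ‖q‖ ≤ 4 := by
  have h0 : 0 ≤ |q.2| ^ ((1 : ℝ) / 2) := by positivity
  rw [parNorm] at hq
  rw [Prod.norm_def, max_le_iff, Real.norm_eq_abs]
  refine ⟨by linarith, ?_⟩
  rw [abs_snd_eq_sq]
  nlinarith [norm_nonneg q.1]

lemma lt_norm_of_lt_parNorm {n : ℕ} {q : Rn1 n} (hq : 1 / 2 < parNorm q) : 1 / 32 < ‖q‖ := by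
  by_contra! h
  rw [Prod.norm_def, max_le_iff, Real.norm_eq_abs, abs_snd_eq_sq] at h
  have h0 : 0 ≤ |q.2| ^ ((1 : ℝ) / 2) := by positivity
  rw [parNorm] at hq
  nlinarith

/-- A bump function equal to `1` where the parabolic size is at most `2`. -/
def outerBump (n : ℕ) : ContDiffBump (0 : Rn1 n) := ⟨4, 5, by norm_num, by norm_num⟩

/-- A bump function vanishing where the parabolic size exceeds `1/2`. -/
def innerBump (n : ℕ) : ContDiffBump (0 : Rn1 n) := ⟨1 / 64, 1 / 32, by norm_num, by norm_num⟩

lemma outerBump_eq_one {n : ℕ} {q : Rn1 n} (hq : parNorm q ≤ 2) : outerBump n q = 1 :=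
  (outerBump n).one_of_mem_closedBall (mem_closedBall_zero_iff.2 (norm_le_of_parNorm_le hq))

lemma innerBump_eq_zero {n : ℕ} {q : Rn1 n} (hq : 1 / 2 < parNorm q) : innerBump n q = 0 :=
  (innerBump n).zero_of_le_dist (by
    rw [dist_zero_right]; exact (lt_norm_of_lt_parNorm hq).le)

lemma exists_schwartz_eq_mul_outerBump {n : ℕ} {h : Rn1 n → ℂ} (hh : ContDiff ℝ (⊤ : ℕ∞) h) :
    ∃ S : 𝓢(Rn1 n, ℂ), ⇑S = fun q => h q * (outerBump n q : ℂ) := by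
  have hb : HasCompactSupport (fun q => h q * (outerBump n q : ℂ)) :=
    ((outerBump n).hasCompactSupport.comp_left (g := fun x : ℝ => (x : ℂ)) rfl).mul_left
  exact ⟨hb.toSchwartzMap (hh.mul (Complex.ofRealCLM.contDiff.comp (outerBump n).contDiff)), rfl⟩

lemma contDiff_fst_apply {n : ℕ} (k : Fin n) : ContDiff ℝ (⊤ : ℕ∞) (fun q : Rn1 n => (q.1 k : ℂ)) :=
  Complex.ofRealCLM.contDiff.comp ((contDiff_euclidean.1 contDiff_fst) k)

lemma exists_isL1Symbol_eq_firstSymbol {n : ℕ} (o : Option (Fin n)) :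
    ∃ m : Rn1 n → ℂ, IsL1Symbol m ∧ ∀ q, parNorm q ≤ 2 → m q = firstSymbol o q := by
  refine ⟨fun q => firstSymbol o q * (outerBump n q : ℂ), ?_, fun q hq => by
    simp [outerBump_eq_one hq]⟩
  cases o with
  | none =>
    obtain ⟨S, hS⟩ := exists_schwartz_eq_mul_outerBump (n := n) (h := fun _ => 1) contDiff_const
    simpa [firstSymbol, hS] using isL1Symbol_half_mul S
  | some k =>
    obtain ⟨S, hS⟩ := exists_schwartz_eq_mul_outerBump
      (h := firstSymbol (some k)) (contDiff_const.mul (contDiff_fst_apply k))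
    exact hS ▸ isL1Symbol_schwartz S

/-- A smooth positive function equal to `|ξ|⁴ + τ²` away from the origin. -/
def quartic {n : ℕ} (q : Rn1 n) : ℝ := (‖q.1‖ ^ 2) ^ 2 + q.2 ^ 2 + innerBump n q

lemma contDiff_quartic {n : ℕ} : ContDiff ℝ (⊤ : ℕ∞) (quartic (n := n)) :=
  ((((contDiff_norm_sq ℝ).comp contDiff_fst).pow 2).add (contDiff_snd.pow 2)).add
    (innerBump n).contDiff

lemma quartic_pos {n : ℕ} (q : Rn1 n) : 0 < quartic q := by
  have hb : 0 ≤ innerBump n q := (innerBump n).nonneg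
  rcases eq_or_ne q 0 with rfl | hq
  · have : innerBump n 0 = 1 :=
      (innerBump n).one_of_mem_closedBall (by simp [innerBump])
    simp [quartic, this]
  · rw [quartic]
    by_cases h1 : q.1 = 0
    · have h2 : q.2 ≠ 0 := fun h2 => hq (Prod.ext h1 h2)
      positivity
    · have := norm_pos_iff.2 h1
      positivity

/-- On the annulus `1/2 < |ξ| + |τ|^{1/2} < 2` the symbols `firstSymbol o` generate the unit ideal
of the algebra of Fourier transforms of integrable functions. -/
lemma exists_isL1Symbol_sum_mul_firstSymbol {n : ℕ} :
    ∃ l : Option (Fin n) → Rn1 n → ℂ, (∀ o, IsL1Symbol (l o)) ∧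
      ∀ q : Rn1 n, 1 / 2 < parNorm q → parNorm q < 2 → ∑ o, l o q * firstSymbol o q = 1 := by
  have hQ : ContDiff ℝ (⊤ : ℕ∞) (fun q : Rn1 n => ((quartic q)⁻¹ : ℂ)) := by
    have := Complex.ofRealCLM.contDiff.comp
      ((contDiff_quartic (n := n)).inv fun q => (quartic_pos q).ne')
    simpa [Function.comp_def] using this
  have hN : ContDiff ℝ (⊤ : ℕ∞) (fun q : Rn1 n => ((‖q.1‖ ^ 2 : ℝ) : ℂ)) :=
    Complex.ofRealCLM.contDiff.comp ((contDiff_norm_sq ℝ).comp contDiff_fst)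
  obtain ⟨S₁, hS₁⟩ := exists_schwartz_eq_mul_outerBump (n := n) (h := fun _ => 1) contDiff_const
  obtain ⟨S₂, hS₂⟩ := exists_schwartz_eq_mul_outerBump hQ
  have hk : ∀ k : Fin n, ∃ S : 𝓢(Rn1 n, ℂ), ⇑S = fun q : Rn1 n =>
      ((2 * π * I)⁻¹ * (q.1 k : ℂ) * ((‖q.1‖ ^ 2 : ℝ) : ℂ) * ((quartic q)⁻¹ : ℂ)) *
        (outerBump n q : ℂ) := fun k =>
    exists_schwartz_eq_mul_outerBump
      (((contDiff_const.mul (contDiff_fst_apply k)).mul hN).mul hQ)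
  choose S hS using hk
  refine ⟨fun o => match o with
    | none => fun q => (((|q.2| ^ ((1 : ℝ) / 2) : ℝ) : ℂ) * S₁ q) *
        ((((|q.2| ^ ((1 : ℝ) / 2) : ℝ) : ℂ) * S₁ q) *
          (((|q.2| ^ ((1 : ℝ) / 2) : ℝ) : ℂ) * S₂ q))
    | some k => S k, fun o => ?_, fun q h1 h2 => ?_⟩
  · cases o with
    | none =>
      exact (isL1Symbol_half_mul S₁).mul
        ((isL1Symbol_half_mul S₁).mul (isL1Symbol_half_mul S₂))
    | some k => exact isL1Symbol_schwartz (S k)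
  · rw [Fintype.sum_option]
    simp only [hS, hS₁, hS₂, firstSymbol, outerBump_eq_one h2.le]
    have hpi : (π : ℂ) ≠ 0 := by exact_mod_cast Real.pi_ne_zero
    have hsum : ∑ k : Fin n, (2 * π * I)⁻¹ * (q.1 k : ℂ) * ((‖q.1‖ ^ 2 : ℝ) : ℂ) *
        ((quartic q)⁻¹ : ℂ) * ((1 : ℝ) : ℂ) * (2 * π * I * q.1 k) =
        (((‖q.1‖ ^ 2) ^ 2 : ℝ) : ℂ) * ((quartic q)⁻¹ : ℂ) := by
      rw [pow_two (‖q.1‖ ^ 2), Complex.ofReal_mul]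
      nth_rewrite 2 [EuclideanSpace.real_norm_sq_eq]
      push_cast
      rw [Finset.sum_mul, Finset.sum_mul]
      refine Finset.sum_congr rfl fun k _ => ?_
      field_simp [Complex.I_ne_zero]
    have hhalf : (((|q.2| ^ ((1 : ℝ) / 2) : ℝ) : ℂ)) ^ 4 = ((q.2 ^ 2 : ℝ) : ℂ) := by
      rw [← Complex.ofReal_pow, ← sq_abs q.2]
      nth_rewrite 2 [abs_snd_eq_sq q]
      rw [← pow_mul]
    have hq : (quartic q : ℂ) = (((‖q.1‖ ^ 2) ^ 2 : ℝ) : ℂ) + ((q.2 ^ 2 : ℝ) : ℂ) := by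
      rw [quartic, innerBump_eq_zero h1, add_zero, Complex.ofReal_add]
    have hq0 : (quartic q : ℂ) ≠ 0 := by exact_mod_cast (quartic_pos q).ne'
    rw [hsum]
    calc _ = (((|q.2| ^ ((1 : ℝ) / 2) : ℝ) : ℂ) ^ 4 + (((‖q.1‖ ^ 2) ^ 2 : ℝ) : ℂ)) *
          ((quartic q)⁻¹ : ℂ) := by push_cast; ring
      _ = 1 := by rw [hhalf, add_comm, ← hq, mul_inv_cancel₀ hq0]

/-! ### Estimates for a single frequency block -/

/-- The operators `D_t^{1/2}` and `∂_{X_k}`, with symbols `firstSymbol`. -/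
def firstOp {n : ℕ} : Option (Fin n) → (Rn1 n → ℂ) → Rn1 n → ℂ
  | none, f => halfDt f
  | some k, f => dX k f

lemma firstOp_eq {n : ℕ} (o : Option (Fin n)) (f : 𝓢(Rn1 n, ℂ)) :
    firstOp o f = IFT1 (fun q => firstSymbol o q * FT1 f q) := by
  cases o with
  | none => rfl
  | some k =>
    have h : (fun q => firstSymbol (some k) q * FT1 f q) = FT1 (dX k f) := by
      ext q
      rw [FT1_dX, firstSymbol]
    rw [h, firstOp, dX_eq_lineDerivOp, IFT1_FT1]

lemma integrable_FT1_schwartz {n : ℕ} (f : 𝓢(Rn1 n, ℂ)) : Integrable (FT1 f) := by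
  rw [← coe_schwartzFT]
  exact (schwartzFT f).integrable

lemma integrable_firstSymbol_mul {n : ℕ} (o : Option (Fin n)) (f : 𝓢(Rn1 n, ℂ)) :
    Integrable (fun q => firstSymbol o q * FT1 f q) := by
  cases o with
  | none =>
    rw [← coe_schwartzFT]
    have h0 : Integrable (schwartzFT f) := (schwartzFT f).integrable
    have h1 : Integrable (fun q => ‖q‖ ^ 1 * ‖schwartzFT f q‖) :=
      (schwartzFT f).integrable_pow_mul volume 1
    refine (h0.norm.add h1).mono' ?_ (Filter.Eventually.of_forall fun q => ?_)
    · refine Continuous.aestronglyMeasurable ?_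
      have := (schwartzFT f).continuous
      simp only [firstSymbol, ← Real.sqrt_eq_rpow]
      fun_prop
    · have h2 : |q.2| ≤ ‖q‖ := norm_snd_le q
      have h3 : |q.2| ^ ((1 : ℝ) / 2) ≤ 1 + ‖q‖ := by
        rw [← Real.sqrt_eq_rpow]
        exact Real.sqrt_le_iff.2 ⟨by positivity, by nlinarith [norm_nonneg q]⟩
      rw [firstSymbol, norm_mul, Complex.norm_real, Real.norm_eq_abs,
        abs_of_nonneg (by positivity)]
      simp only [Pi.add_apply]
      nlinarith [norm_nonneg (schwartzFT f q)]
  | some k =>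
    have h : (fun q => firstSymbol (some k) q * FT1 f q) = FT1 (dX k f) := by
      ext q
      rw [FT1_dX, firstSymbol]
    rw [h, dX_eq_lineDerivOp]
    exact integrable_FT1_schwartz _

lemma integrable_FT1_mul {n : ℕ} {K G : Rn1 n → ℂ} (hK : Integrable K) (hG : Integrable G) :
    Integrable (fun q => FT1 K q * G q) := by
  refine hG.bdd_mul (c := ∫ x, ‖K x‖) ?_ (Filter.Eventually.of_forall fun q => ?_)
  · have h : AEStronglyMeasurable (fun z : Rn1 n × Rn1 n => echar (-pairing z.2 z.1) * K z.2)
        (volume.prod volume) :=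
      (continuous_echar.comp
        (continuous_pairing.comp continuous_swap).neg).aestronglyMeasurable.mul
          hK.aestronglyMeasurable.comp_snd
    simpa only [← FT1_eq] using h.integral_prod_right'
  · rw [FT1_eq]
    refine (norm_integral_le_integral_norm _).trans_eq ?_
    simp only [norm_mul, norm_echar, one_mul]

lemma conv1_schwartz {n : ℕ} {A : Rn1 n → ℂ} (hA : Integrable A) (f : 𝓢(Rn1 n, ℂ)) :
    conv1 A f = IFT1 (fun q => FT1 A q * FT1 f q) := by
  rw [← conv1_IFT1 hA (integrable_FT1_schwartz f), IFT1_FT1]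

lemma conv1_firstOp {n : ℕ} {A : Rn1 n → ℂ} (hA : Integrable A) (o : Option (Fin n))
    (f : 𝓢(Rn1 n, ℂ)) :
    conv1 A (firstOp o f) = IFT1 (fun q => FT1 A q * (firstSymbol o q * FT1 f q)) := by
  rw [firstOp_eq, conv1_IFT1 hA (integrable_firstSymbol_mul o f)]

lemma IFT1_const_mul {n : ℕ} (c : ℂ) (G : Rn1 n → ℂ) :
    IFT1 (fun q => c * G q) = c • IFT1 G := by
  ext x
  rw [Pi.smul_apply, smul_eq_mul, IFT1_eq, IFT1_eq, ← integral_const_mul]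
  congr 1; ext q; ring

lemma IFT1_sum {n : ℕ} {ι : Type*} (s : Finset ι) {G : ι → Rn1 n → ℂ}
    (hG : ∀ i, Integrable (G i)) :
    IFT1 (fun q => ∑ i ∈ s, G i q) = ∑ i ∈ s, IFT1 (G i) := by
  ext x
  simp only [IFT1_eq, Finset.mul_sum, Finset.sum_apply]
  exact integral_finsetSum _ fun i _ => integrable_echar_mul (hG i)
    (continuous_pairing.comp (Continuous.prodMk_left x))

/-- A multiplier which is the dilate of an `L¹` symbol is bounded on `Lᵖ`. -/
lemma eLpNorm_IFT1_parScale_le {n : ℕ} {K G : Rn1 n → ℂ} (hK : Integrable K)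
    (hG : Integrable G) {r : ℝ} (hr : 0 < r) {p : ℝ} (hp : 1 ≤ p) :
    eLpNorm (IFT1 fun q => FT1 K (parScale r⁻¹ q) * G q) (ENNReal.ofReal p) volume ≤
      (∫⁻ x, ‖K x‖ₑ) * eLpNorm (IFT1 G) (ENNReal.ofReal p) volume := by
  simp only [← FT1_parDilate hr]
  rw [← conv1_IFT1 (integrable_parDilate hr hK) hG, ← lintegral_parDilate hr hK]
  exact eLpNorm_conv1_le (integrable_parDilate hr hK).aestronglyMeasurable
    (aestronglyMeasurable_IFT1 hG) hp

lemma eLpNorm_conv1_firstOp_le {n : ℕ} {A K : Rn1 n → ℂ} (hA : Integrable A) (hK : Integrable K)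
    {r : ℝ} (hr : 0 < r) (o : Option (Fin n))
    (h : ∀ q, FT1 A q ≠ 0 → FT1 K (parScale r⁻¹ q) = firstSymbol o (parScale r⁻¹ q))
    (f : 𝓢(Rn1 n, ℂ)) {p : ℝ} (hp : 1 ≤ p) :
    eLpNorm (conv1 A (firstOp o f)) (ENNReal.ofReal p) volume ≤
      ENNReal.ofReal r * ((∫⁻ x, ‖K x‖ₑ) * eLpNorm (conv1 A f) (ENNReal.ofReal p) volume) := by
  have hsym : (fun q => FT1 A q * (firstSymbol o q * FT1 f q)) =
      fun q => (r : ℂ) * (FT1 K (parScale r⁻¹ q) * (FT1 A q * FT1 f q)) := by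
    ext q
    by_cases hq : FT1 A q = 0
    · simp [hq]
    · rw [h q hq]
      have hs : firstSymbol o q = r * firstSymbol o (parScale r⁻¹ q) := by
        rw [← firstSymbol_parScale hr, parScale_inv' hr]
      rw [hs]
      ring
  rw [conv1_firstOp hA, conv1_schwartz hA, hsym, IFT1_const_mul, eLpNorm_const_smul,
    ← ofReal_norm, Complex.norm_real, Real.norm_eq_abs, abs_of_pos hr]
  gcongr
  exact eLpNorm_IFT1_parScale_le hK (integrable_FT1_mul hA (integrable_FT1_schwartz f)) hr hp

lemma eLpNorm_conv1_le_sum_firstOp {n : ℕ} {A : Rn1 n → ℂ} {L : Option (Fin n) → Rn1 n → ℂ}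
    (hA : Integrable A) (hL : ∀ o, Integrable (L o)) {r : ℝ} (hr : 0 < r)
    (h : ∀ q, FT1 A q ≠ 0 →
      ∑ o, FT1 (L o) (parScale r⁻¹ q) * firstSymbol o (parScale r⁻¹ q) = 1)
    (f : 𝓢(Rn1 n, ℂ)) {p : ℝ} (hp : 1 ≤ p) :
    ENNReal.ofReal r * eLpNorm (conv1 A f) (ENNReal.ofReal p) volume ≤
      ∑ o, (∫⁻ x, ‖L o x‖ₑ) * eLpNorm (conv1 A (firstOp o f)) (ENNReal.ofReal p) volume := by
  have hsym : (fun q => (r : ℂ) * (FT1 A q * FT1 f q)) =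
      fun q => ∑ o, FT1 (L o) (parScale r⁻¹ q) *
        (FT1 A q * (firstSymbol o q * FT1 f q)) := by
    ext q
    by_cases hq : FT1 A q = 0
    · simp [hq]
    · have hs : ∀ o : Option (Fin n),
          firstSymbol o q = r * firstSymbol o (parScale r⁻¹ q) := fun o => by
        rw [← firstSymbol_parScale hr, parScale_inv' hr]
      simp only [hs]
      rw [← one_mul ((r : ℂ) * (FT1 A q * FT1 f q)), ← h q hq, Finset.sum_mul]
      exact Finset.sum_congr rfl fun o _ => by ring
  have hG : ∀ o, Integrable (fun q => FT1 A q * (firstSymbol o q * FT1 f q)) := fun o =>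
    integrable_FT1_mul hA (integrable_firstSymbol_mul o f)
  have hG' : ∀ o, Integrable (fun q => FT1 (L o) (parScale r⁻¹ q) *
      (FT1 A q * (firstSymbol o q * FT1 f q))) := fun o => by
    simpa only [FT1_parDilate hr] using
      integrable_FT1_mul (integrable_parDilate hr (hL o)) (hG o)
  calc ENNReal.ofReal r * eLpNorm (conv1 A f) (ENNReal.ofReal p) volume
      = eLpNorm (IFT1 fun q => (r : ℂ) * (FT1 A q * FT1 f q)) (ENNReal.ofReal p) volume := by
        rw [conv1_schwartz hA, IFT1_const_mul, eLpNorm_const_smul, ← ofReal_norm,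
          Complex.norm_real, Real.norm_eq_abs, abs_of_pos hr]
    _ ≤ ∑ o, eLpNorm (IFT1 fun q => FT1 (L o) (parScale r⁻¹ q) *
          (FT1 A q * (firstSymbol o q * FT1 f q))) (ENNReal.ofReal p) volume := by
        rw [hsym, IFT1_sum _ hG']
        exact eLpNorm_sum_le (fun o _ => aestronglyMeasurable_IFT1 (hG' o))
          (by simpa using hp)
    _ ≤ _ := by
        refine Finset.sum_le_sum fun o _ => ?_
        rw [conv1_firstOp hA]
        exact eLpNorm_IFT1_parScale_le (hL o) (hG o) hr hp

/-! ### Frequency supports -/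

lemma parNorm_lt_of_FT1_phi_ne_zero {n : ℕ} (P : ParabolicLP n) {q : Rn1 n}
    (hq : FT1 P.φ q ≠ 0) : 1 / 2 < parNorm q ∧ parNorm q < 2 := by
  by_contra h
  exact hq (P.ft_supp q h)

lemma parNorm_lt_of_FT1_psi_ne_zero {n : ℕ} (P : ParabolicLP n) {q : Rn1 n}
    (hq : FT1 P.ψ q ≠ 0) : parNorm q < 2 := by
  by_contra! h
  refine hq ?_
  have hq0 : q ≠ 0 := by
    rintro rfl
    norm_num [parNorm] at h
  rw [P.ft_psi q, ← P.ft_sum q hq0, sub_eq_zero]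
  have hinj : Function.Injective (fun i : ℕ => (i : ℤ) + 1) := fun i j hij => by
    simpa using hij
  refine (hinj.tsum_eq fun i hi => ?_).symm
  by_contra hneg
  have hi0 : i ≤ 0 := by
    by_contra! hpos
    exact hneg ⟨(i - 1).toNat, by simp only; omega⟩
  have hscale : (((2 : ℝ) ^ (-i)) • q.1, ((2 : ℝ) ^ (-(2 * i))) * q.2) =
      parScale ((2 : ℝ) ^ (-i)) q := by
    rw [parScale, ← zpow_natCast, ← zpow_mul]
    congr 3
    push_cast
    ring
  have hi' : FT1 P.φ (parScale ((2 : ℝ) ^ (-i)) q) ≠ 0 := by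
    rw [← hscale]
    exact hi
  have hlt := (parNorm_lt_of_FT1_phi_ne_zero P hi').2
  rw [parNorm_parScale (by positivity)] at hlt
  have h1 : (1 : ℝ) ≤ 2 ^ (-i) := one_le_zpow₀ one_le_two (by omega)
  nlinarith

lemma integrable_lpPhi {n : ℕ} (P : ParabolicLP n) (i : ℕ) : Integrable (lpPhi P i) := by
  rw [lpPhi_eq]
  exact integrable_parDilate (by positivity) P.φ.integrable

lemma parNorm_lt_of_FT1_lpPhi_ne_zero {n : ℕ} (P : ParabolicLP n) {i : ℕ} {q : Rn1 n}
    (hq : FT1 (lpPhi P i) q ≠ 0) :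
    1 / 2 < parNorm (parScale ((2 : ℝ) ^ i)⁻¹ q) ∧
      parNorm (parScale ((2 : ℝ) ^ i)⁻¹ q) < 2 := by
  rw [lpPhi_eq, FT1_parDilate (by positivity)] at hq
  exact parNorm_lt_of_FT1_phi_ne_zero P hq

/-! ### Summation over frequency blocks -/

/-- Minkowski's inequality for finite sums of `ℓᵖ` sequences. -/
lemma tsum_sum_rpow_le {ι : Type*} (s : Finset ι) (x : ι → ℕ → ℝ≥0∞) {p : ℝ} (hp : 1 ≤ p) :
    (∑' i, (∑ o ∈ s, x o i) ^ p) ^ (1 / p) ≤ ∑ o ∈ s, (∑' i, x o i ^ p) ^ (1 / p) := by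
  have hp0 : 0 < p := by linarith
  classical
  induction s using Finset.induction_on with
  | empty => simp [hp0]
  | insert a s ha ih =>
    have h := ENNReal.lintegral_Lp_add_le (μ := (Measure.count : Measure ℕ))
      (f := x a) (g := fun i => ∑ o ∈ s, x o i) (by fun_prop) (by fun_prop) hp
    simp only [lintegral_count, Pi.add_apply] at h
    simp only [Finset.sum_insert ha]
    exact h.trans (add_le_add_right ih _)

lemma tsum_mul_rpow {c : ℝ≥0∞} (x : ℕ → ℝ≥0∞) {p : ℝ} (hp : 1 ≤ p) :
    (∑' i, (c * x i) ^ p) ^ (1 / p) = c * (∑' i, x i ^ p) ^ (1 / p) := by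
  have hp0 : 0 < p := by linarith
  simp only [ENNReal.mul_rpow_of_nonneg _ _ hp0.le, ENNReal.tsum_mul_left]
  rw [ENNReal.mul_rpow_of_nonneg _ _ (by positivity), ← ENNReal.rpow_mul,
    mul_one_div_cancel hp0.ne', ENNReal.rpow_one]

lemma pBesov_le_mul {n : ℕ} (P : ParabolicLP n) {s s' p : ℝ} (hp : 1 ≤ p) {κ : ℝ≥0∞}
    {f g : Rn1 n → ℂ}
    (h0 : eLpNorm (conv1 P.ψ g) (ENNReal.ofReal p) volume ≤
      κ * eLpNorm (conv1 P.ψ f) (ENNReal.ofReal p) volume)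
    (h1 : ∀ i : ℕ, ENNReal.ofReal ((2 : ℝ) ^ (s' * ((i : ℝ) + 1))) *
        eLpNorm (conv1 (lpPhi P (i + 1)) g) (ENNReal.ofReal p) volume ≤
      κ * (ENNReal.ofReal ((2 : ℝ) ^ (s * ((i : ℝ) + 1))) *
        eLpNorm (conv1 (lpPhi P (i + 1)) f) (ENNReal.ofReal p) volume)) :
    pBesov P s' p g ≤ κ * pBesov P s p f := by
  rw [pBesov, pBesov, mul_add, ← tsum_mul_rpow _ hp]
  refine add_le_add h0 (ENNReal.rpow_le_rpow (ENNReal.tsum_le_tsum fun i =>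
    ENNReal.rpow_le_rpow (h1 i) (by linarith)) (by positivity))

lemma ofReal_two_rpow_eq (α : ℝ) (i : ℕ) :
    ENNReal.ofReal ((2 : ℝ) ^ (α * ((i : ℝ) + 1))) =
      ENNReal.ofReal ((2 : ℝ) ^ ((α - 1) * ((i : ℝ) + 1))) * ENNReal.ofReal (2 ^ (i + 1)) := by
  rw [← ENNReal.ofReal_mul (by positivity), ← Real.rpow_natCast, ← Real.rpow_add two_pos]
  congr 2
  push_cast
  ring

lemma pBesov_sub_one_le {n : ℕ} (P : ParabolicLP n) (α : ℝ) {p : ℝ} (hp : 1 ≤ p)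
    (f : Rn1 n → ℂ) : pBesov P (α - 1) p f ≤ pBesov P α p f := by
  rw [← one_mul (pBesov P α p f)]
  refine pBesov_le_mul P hp (one_mul _).ge fun i => ?_
  rw [one_mul]
  gcongr
  · exact one_le_two
  · linarith

lemma exists_pBesov_firstOp_le {n : ℕ} (P : ParabolicLP n) (α : ℝ) {p : ℝ} (hp : 1 ≤ p)
    (o : Option (Fin n)) :
    ∃ κ : ℝ≥0∞, κ ≠ ⊤ ∧ ∀ f : 𝓢(Rn1 n, ℂ),
      pBesov P (α - 1) p (firstOp o f) ≤ κ * pBesov P α p f := by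
  obtain ⟨m, ⟨K, hK, rfl⟩, hm⟩ := exists_isL1Symbol_eq_firstSymbol o
  refine ⟨∫⁻ x, ‖K x‖ₑ, hK.2.ne, fun f => pBesov_le_mul P hp ?_ fun i => ?_⟩
  · have := eLpNorm_conv1_firstOp_le (A := P.ψ) P.ψ.integrable hK one_pos o
      (fun q hq => hm _ (by
        rw [parNorm_parScale (by norm_num), inv_one, one_mul]
        exact (parNorm_lt_of_FT1_psi_ne_zero P hq).le)) f hp
    simpa using this
  · have := eLpNorm_conv1_firstOp_le (integrable_lpPhi P (i + 1)) hK
      (pow_pos two_pos (i + 1)) o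
      (fun q hq => hm _ (parNorm_lt_of_FT1_lpPhi_ne_zero P hq).2.le) f hp
    rw [ofReal_two_rpow_eq α]
    refine (mul_le_mul_right this _).trans_eq ?_
    ring

lemma exists_pBesov_le_sum_firstOp {n : ℕ} (P : ParabolicLP n) (α : ℝ) {p : ℝ} (hp : 1 ≤ p) :
    ∃ κ : ℝ≥0∞, κ ≠ ⊤ ∧ ∀ f : 𝓢(Rn1 n, ℂ),
      pBesov P α p f ≤
        κ * (pBesov P (α - 1) p f + ∑ o, pBesov P (α - 1) p (firstOp o f)) := by
  obtain ⟨l, hl, hsum⟩ := exists_isL1Symbol_sum_mul_firstSymbol (n := n)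
  choose L hL hLl using hl
  set lam : Option (Fin n) → ℝ≥0∞ := fun o => ∫⁻ x, ‖L o x‖ₑ with hlam
  have hlam_top : ∀ o, lam o ≠ ⊤ := fun o => (hL o).2.ne
  refine ⟨1 + ∑ o, lam o, by simp [hlam_top], fun f => ?_⟩
  have hblock : ∀ i : ℕ, ENNReal.ofReal ((2 : ℝ) ^ (α * ((i : ℝ) + 1))) *
        eLpNorm (conv1 (lpPhi P (i + 1)) f) (ENNReal.ofReal p) volume ≤
      ∑ o, lam o * (ENNReal.ofReal ((2 : ℝ) ^ ((α - 1) * ((i : ℝ) + 1))) *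
        eLpNorm (conv1 (lpPhi P (i + 1)) (firstOp o f)) (ENNReal.ofReal p) volume) := by
    intro i
    have := eLpNorm_conv1_le_sum_firstOp (integrable_lpPhi P (i + 1)) hL
      (pow_pos two_pos (i + 1)) (fun q hq => by
        have hq' := parNorm_lt_of_FT1_lpPhi_ne_zero P hq
        simp only [hLl]
        exact hsum _ hq'.1 hq'.2) f hp
    rw [ofReal_two_rpow_eq, mul_assoc]
    refine (mul_le_mul_right this _).trans_eq ?_
    rw [Finset.mul_sum]
    exact Finset.sum_congr rfl fun o _ => by ring
  calc pBesov P α p f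
      ≤ pBesov P (α - 1) p f + ∑ o, lam o * pBesov P (α - 1) p (firstOp o f) := by
        rw [pBesov]
        refine add_le_add (by rw [pBesov]; exact le_self_add) ?_
        refine (ENNReal.rpow_le_rpow (ENNReal.tsum_le_tsum fun i =>
          ENNReal.rpow_le_rpow (hblock i) (by linarith)) (by positivity)).trans ?_
        refine (tsum_sum_rpow_le _ _ hp).trans (Finset.sum_le_sum fun o _ => ?_)
        rw [tsum_mul_rpow _ hp]
        gcongr
        rw [pBesov]
        exact le_add_self
    _ ≤ _ := by
        rw [mul_add]
        refine add_le_add ?_ ?_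
        · exact le_mul_of_one_le_left zero_le le_self_add
        · rw [Finset.mul_sum]
          refine Finset.sum_le_sum fun o _ => ?_
          gcongr
          exact (Finset.single_le_sum (fun _ _ => zero_le) (Finset.mem_univ o)).trans
            le_add_self

/-- Parabolic Besov equivalence
`N_{α,p}(f) ≈ N_{α−1,p}(f) + Σ_k N_{α−1,p}(∂_{X_k}f) + N_{α−1,p}(D_t^{1/2}f)`. -/
theorem stmt7 (n : ℕ) (hn : 1 ≤ n) (p : ℝ) (hp : 1 ≤ p) (α : ℝ) (P : ParabolicLP n) :
    ∃ c C : ℝ, 0 < c ∧ 0 < C ∧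
      ∀ f : SchwartzMap (Rn1 n) ℂ,
        ENNReal.ofReal c * pBesov P α p ⇑f ≤
            pBesov P (α - 1) p ⇑f
            + ∑ k : Fin n, pBesov P (α - 1) p (dX k ⇑f)
            + pBesov P (α - 1) p (halfDt ⇑f)
          ∧
          pBesov P (α - 1) p ⇑f
            + ∑ k : Fin n, pBesov P (α - 1) p (dX k ⇑f)
            + pBesov P (α - 1) p (halfDt ⇑f)
            ≤ ENNReal.ofReal C * pBesov P α p ⇑f := by
  choose κ hκ hle using exists_pBesov_firstOp_le P α hp
  obtain ⟨lam, hlam, hge⟩ := exists_pBesov_le_sum_firstOp P α hp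
  have hreorder : ∀ f : 𝓢(Rn1 n, ℂ),
      pBesov P (α - 1) p f + ∑ k : Fin n, pBesov P (α - 1) p (dX k f)
        + pBesov P (α - 1) p (halfDt f) =
      pBesov P (α - 1) p f + ∑ o, pBesov P (α - 1) p (firstOp o f) := fun f => by
    rw [Fintype.sum_option, add_assoc, add_comm (∑ k : Fin n, _)]
    rfl
  have hC : 1 + ∑ o, κ o ≠ ⊤ := by simp [hκ]
  refine ⟨(lam.toReal + 1)⁻¹, (1 + ∑ o, κ o).toReal, by positivity,
    ENNReal.toReal_pos (by simp) hC, fun f => ?_⟩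
  rw [hreorder, ENNReal.ofReal_toReal hC]
  constructor
  · rw [ENNReal.ofReal_inv_of_pos (by positivity), ← ENNReal.div_eq_inv_mul]
    refine ENNReal.div_le_of_le_mul' ((hge f).trans ?_)
    gcongr
    rw [ENNReal.le_ofReal_iff_toReal_le hlam (by positivity)]
    linarith
  · rw [add_mul, one_mul, Finset.sum_mul]
    exact add_le_add (pBesov_sub_one_le P α hp f) (Finset.sum_le_sum fun o _ => hle o f)
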